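/- If 0 ≤ p_i^ego ≤ 1 and 0 ≤ p_i^bio ≤ 1 for all i, then the steady-state personal norms with social influence, p̄ = (C + D + 𝓛)^{-1}(C p^ego + D p^bio), satisfy 0 ≤ p̄_i ≤ 1 for all i. -/

import Mathlib

open Matrix

/-- Discrete maximum principle for a Laplacian with positive absorption `a`. -/
theorem le_of_absorption_add_sum_le {ι : Type*} [Fintype ι] {a x : ι → ℝ} {b : ι → ι → ℝ}
    {M : ℝ} (ha : ∀ i, 0 < a i) (hb : ∀ i j, 0 ≤ b i j)
    (h : ∀ i, a i * x i + ∑ k, b i k * (x i - x k) ≤ a i * M) (i : ι) : x i ≤ M := by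
  have : Nonempty ι := ⟨i⟩
  obtain ⟨m, hm⟩ := Finite.exists_max x
  refine (hm i).trans (le_of_mul_le_mul_left ?_ (ha m))
  have hsum : 0 ≤ ∑ k, b m k * (x m - x k) :=
    Finset.sum_nonneg fun k _ => mul_nonneg (hb m k) (sub_nonneg.2 (hm k))
  linarith [h m]

theorem laplacian_mulVec_apply {ι : Type*} [Fintype ι] [DecidableEq ι] {b : ι → ι → ℝ}
    {L : Matrix ι ι ℝ}
    (hL : ∀ i j, L i j = if i = j then ∑ k ∈ Finset.univ.erase i, b i k else -(b i j))
    (x : ι → ℝ) (i : ι) : (L *ᵥ x) i = ∑ k, b i k * (x i - x k) := by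
  rw [Matrix.mulVec, dotProduct, ← Finset.add_sum_erase _ _ (Finset.mem_univ i),
    ← Finset.add_sum_erase _ (fun k => b i k * (x i - x k)) (Finset.mem_univ i), hL i i,
    if_pos rfl, Finset.sum_mul, sub_self, mul_zero, zero_add, ← Finset.sum_add_distrib]
  refine Finset.sum_congr rfl fun k hk => ?_
  rw [hL i k, if_neg (Finset.ne_of_mem_erase hk).symm]
  ring

/-- If 0 ≤ p^ego ≤ 1 and 0 ≤ p^bio ≤ 1 componentwise, then the steady-state
personal norms with social influence p̄ = (C + D + 𝓛)⁻¹(C p^ego + D p^bio) satisfy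
0 ≤ p̄ᵢ ≤ 1 for all i. -/
theorem stmt_4 (N : ℕ) (hN : 1 ≤ N) (c d pego pbio : Fin N → ℝ)
    (hc : ∀ i, 0 ≤ c i) (hd : ∀ i, 0 ≤ d i) (hcd : ∀ i, 0 < c i + d i)
    (b : Fin N → Fin N → ℝ) (hb : ∀ i j, 0 ≤ b i j) (hbsym : ∀ i j, b i j = b j i)
    (L : Matrix (Fin N) (Fin N) ℝ)
    (hL : ∀ i j, L i j =
      if i = j then ∑ k ∈ Finset.univ.erase i, b i k else -(b i j))
    (hego : ∀ i, 0 ≤ pego i ∧ pego i ≤ 1) (hbio : ∀ i, 0 ≤ pbio i ∧ pbio i ≤ 1)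
    (pbar : Fin N → ℝ)
    (hpbar : pbar = (Matrix.diagonal c + Matrix.diagonal d + L)⁻¹ *ᵥ
      (Matrix.diagonal c *ᵥ pego + Matrix.diagonal d *ᵥ pbio)) :
    ∀ i, 0 ≤ pbar i ∧ pbar i ≤ 1 := by
  have hmul : ∀ (x : Fin N → ℝ) (i : Fin N),
      ((Matrix.diagonal c + Matrix.diagonal d + L) *ᵥ x) i =
        (c i + d i) * x i + ∑ k, b i k * (x i - x k) := by
    intro x i
    rw [Matrix.add_mulVec, Matrix.add_mulVec, Pi.add_apply, Pi.add_apply,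
      Matrix.mulVec_diagonal, Matrix.mulVec_diagonal, laplacian_mulVec_apply hL]
    ring
  have hdet : (Matrix.diagonal c + Matrix.diagonal d + L).det ≠ 0 := by
    intro h0
    obtain ⟨v, hv, hv0⟩ := Matrix.exists_mulVec_eq_zero_iff.2 h0
    have hle : ∀ w, (Matrix.diagonal c + Matrix.diagonal d + L) *ᵥ w = 0 → ∀ i, w i ≤ 0 := by
      intro w hw
      refine le_of_absorption_add_sum_le hcd hb fun i => ?_
      rw [← hmul, hw, mul_zero, Pi.zero_apply]
    refine hv (funext fun i => le_antisymm (hle v hv0 i) ?_)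
    have := hle (-v) (by rw [Matrix.mulVec_neg, hv0, neg_zero]) i
    simpa using this
  have heq : ∀ i, (c i + d i) * pbar i + ∑ k, b i k * (pbar i - pbar k) =
      c i * pego i + d i * pbio i := by
    intro i
    rw [← hmul, hpbar, Matrix.mulVec_mulVec, Matrix.mul_nonsing_inv _ (isUnit_iff_ne_zero.2 hdet),
      Matrix.one_mulVec, Pi.add_apply, Matrix.mulVec_diagonal, Matrix.mulVec_diagonal]
  refine fun i => ⟨?_, ?_⟩
  · have hneg : ∀ j, -pbar j ≤ 0 := by
      refine le_of_absorption_add_sum_le (x := fun j => -pbar j) hcd hb fun j => ?_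
      have hsum : ∑ k, b j k * (-pbar j - -pbar k) = -∑ k, b j k * (pbar j - pbar k) := by
        rw [← Finset.sum_neg_distrib]
        exact Finset.sum_congr rfl fun k _ => by ring
      rw [hsum]
      linarith [heq j, mul_nonneg (hc j) (hego j).1, mul_nonneg (hd j) (hbio j).1]
    exact neg_nonpos.1 (hneg i)
  · refine le_of_absorption_add_sum_le hcd hb (fun j => ?_) i
    rw [heq j]
    linarith [mul_le_mul_of_nonneg_left (hego j).2 (hc j),
      mul_le_mul_of_nonneg_left (hbio j).2 (hd j)]
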